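/- arXiv:1803.00099 — 2 statements merged into one kernel-verified Lean document; each statement's English description precedes it below -/
import Mathlib

section
/- For every monotone function f ∈ F_mon^d, every k ∈ {1,…,d} and every resolution r ∈ ℕ, the Haar wavelet coefficients of f satisfy Σ f̃(α)² ≤ √(d·r)/(k+1), where the sum runs over all α ∈ ℕ₀^d with more than k active variables (|α|₀ > k) and all levels λ_j(α) < r. -/
open MeasureTheory
open scoped ENNReal NNReal

noncomputable section

/-- The unit cube `[0,1]^d`. -/
def unitCube (d : ℕ) : Set (Fin d → ℝ) := Set.Icc 0 1

/-- The class of monotone functions `f : [0,1]^d → [-1,1]`. -/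
def FMon (d : ℕ) : Set ((Fin d → ℝ) → ℝ) :=
  {f | (∀ x ∈ unitCube d, f x ∈ Set.Icc (-1 : ℝ) 1) ∧
       (∀ x ∈ unitCube d, ∀ y ∈ unitCube d, x ≤ y → f x ≤ f y)}

/-- The class of sign-valued monotone functions `f : [0,1]^d → {-1,+1}`. -/
def FMonPM (d : ℕ) : Set ((Fin d → ℝ) → ℝ) :=
  {f | f ∈ FMon d ∧ ∀ x ∈ unitCube d, f x = -1 ∨ f x = 1}

/-- The (extended-real-valued) `L₁([0,1]^d)` distance between two functions. -/
def dist1e {d : ℕ} (g f : (Fin d → ℝ) → ℝ) : ℝ≥0∞ :=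
  ∫⁻ x in unitCube d, ENNReal.ofReal |g x - f x|

/-- The dyadic interval `I_{λ,κ} = [κ2^{-λ}, (κ+1)2^{-λ})`, closed at the right end
for the last one (`κ = 2^λ - 1`). -/
def dyadicI (lam kap : ℕ) : Set ℝ :=
  if kap + 1 = 2 ^ lam then Set.Icc ((kap : ℝ) / 2 ^ lam) 1
  else Set.Ico ((kap : ℝ) / 2 ^ lam) (((kap : ℝ) + 1) / 2 ^ lam)

/-- One-dimensional Haar functions: `ψ₀ = 1_{[0,1]}` and, for `α = 2^λ + κ ≥ 1`,
`ψ_α = 2^{λ/2}(1_{I_{λ+1,2κ+1}} - 1_{I_{λ+1,2κ}})`. -/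
def haar1 (α : ℕ) : ℝ → ℝ :=
  if α = 0 then (Set.Icc (0 : ℝ) 1).indicator 1
  else fun x =>
    Real.sqrt (2 ^ Nat.log 2 α) *
      ((dyadicI (Nat.log 2 α + 1) (2 * (α - 2 ^ Nat.log 2 α) + 1)).indicator 1 x -
        (dyadicI (Nat.log 2 α + 1) (2 * (α - 2 ^ Nat.log 2 α))).indicator 1 x)

/-- The tensor-product Haar function `ψ_α(x) = ∏_j ψ_{α_j}(x_j)`. -/
def haar {d : ℕ} (α : Fin d → ℕ) (x : Fin d → ℝ) : ℝ :=
  ∏ j, haar1 (α j) (x j)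

/-- The Haar wavelet coefficient `f̃(α) = ⟨ψ_α, f⟩`. -/
def wcoef {d : ℕ} (f : (Fin d → ℝ) → ℝ) (α : Fin d → ℕ) : ℝ :=
  ∫ x in unitCube d, haar α x * f x

/-- The number of active variables `|α|₀ = #{j : α_j > 0}`. -/
def activeCount {d : ℕ} (α : Fin d → ℕ) : ℕ :=
  (Finset.univ.filter (fun j => α j ≠ 0)).card

/-- The sign function, with the convention `sgn 0 = 1`. -/
def sgn (t : ℝ) : ℝ := if 0 ≤ t then 1 else -1

/-- The truncated Haar expansion `f_r = Σ_{α : λ(α) < r} f̃(α) ψ_α`; the indices `α ∈ ℕ₀`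
of level `< r` are exactly those with `α < 2^r`. -/
def truncExp {d : ℕ} (f : (Fin d → ℝ) → ℝ) (r : ℕ) : (Fin d → ℝ) → ℝ :=
  fun x => ∑ α : Fin d → Fin (2 ^ r),
    wcoef f (fun j => (α j : ℕ)) * haar (fun j => (α j : ℕ)) x

/-- The distribution of `n` i.i.d. points uniformly distributed on `[0,1]^d`. -/
def sampleMeasure (d n : ℕ) : Measure (Fin n → (Fin d → ℝ)) :=
  Measure.pi (fun _ => volume.restrict (unitCube d))

/-- The linear reconstruction `A_{n,k,r}`: all Haar coefficients with at most `k` active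
variables and level `< r` are estimated by standard Monte Carlo from the samples
`ξ_1, …, ξ_n`. -/
def linAlg (d n k r : ℕ) (ξ : Fin n → (Fin d → ℝ)) (f : (Fin d → ℝ) → ℝ) :
    (Fin d → ℝ) → ℝ :=
  fun x => ∑ α ∈ Finset.univ.filter
      (fun α : Fin d → Fin (2 ^ r) => activeCount (fun j => (α j : ℕ)) ≤ k),
    ((n : ℝ)⁻¹ * ∑ i, haar (fun j => (α j : ℕ)) (ξ i) * f (ξ i)) *
      haar (fun j => (α j : ℕ)) x

/-- The sign-valued reconstruction `Â_{n,k,r} = sgn ∘ A_{n,k,r}`. -/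
def hatAlg (d n k r : ℕ) (ξ : Fin n → (Fin d → ℝ)) (f : (Fin d → ℝ) → ℝ) :
    (Fin d → ℝ) → ℝ :=
  fun x => sgn (linAlg d n k r ξ f x)

/-- The general method `Ā_{n,k,r}(f) = (1/2)∫_{-1}^{1} Â_{n,k,r}(f_t) dt`, where
`f_t = sgn(f - t)`. -/
def barAlg (d n k r : ℕ) (ξ : Fin n → (Fin d → ℝ)) (f : (Fin d → ℝ) → ℝ) :
    (Fin d → ℝ) → ℝ :=
  fun x => (1 / 2) * ∫ t in (-1 : ℝ)..1, hatAlg d n k r ξ (fun y => sgn (f y - t)) x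


/-- **Bessel's inequality** for a finite orthonormal system of real functions in `L²(μ)`. -/
theorem sum_sq_integral_mul_le {Ω ι : Type*} [MeasurableSpace Ω] {μ : Measure Ω}
    (s : Finset ι) (e : ι → Ω → ℝ) (F : Ω → ℝ) (he : ∀ i ∈ s, MemLp (e i) 2 μ) (hF : MemLp F 2 μ)
    (h1 : ∀ i ∈ s, ∫ x, e i x * e i x ∂μ = 1)
    (h0 : ∀ i ∈ s, ∀ j ∈ s, i ≠ j → ∫ x, e i x * e j x ∂μ = 0) :
    ∑ i ∈ s, (∫ x, e i x * F x ∂μ) ^ 2 ≤ ∫ x, F x ^ 2 ∂μ := by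
  set c : ι → ℝ := fun i => ∫ x, e i x * F x ∂μ with hc
  set G : Ω → ℝ := fun x => ∑ i ∈ s, c i * e i x with hG
  have hGm : MemLp G 2 μ := memLp_finsetSum s fun i hi => (he i hi).const_mul (c i)
  have hGG : ∀ j ∈ s, ∫ x, e j x * G x ∂μ = c j := by
    intro j hj
    have : ∀ x, e j x * G x = ∑ i ∈ s, c i * (e j x * e i x) := fun x => by
      rw [hG, Finset.mul_sum]; exact Finset.sum_congr rfl fun i _ => by ring
    simp_rw [this]
    have hint : ∀ i ∈ s, Integrable (fun x => c i * (e j x * e i x)) μ :=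
      fun i hi => ((he j hj).integrable_mul (he i hi)).const_mul (c i)
    rw [integral_finsetSum s hint]
    simp_rw [integral_const_mul]
    rw [Finset.sum_eq_single_of_mem j hj fun i hi hij => by rw [h0 j hj i hi hij.symm, mul_zero],
      h1 j hj, mul_one]
  have key : ∀ H : Ω → ℝ, MemLp H 2 μ → (∀ j ∈ s, ∫ x, e j x * H x ∂μ = c j) →
      ∫ x, G x * H x ∂μ = ∑ i ∈ s, c i ^ 2 := by
    intro H hH hj
    have : ∀ x, G x * H x = ∑ i ∈ s, c i * (e i x * H x) := fun x => by
      rw [hG, Finset.sum_mul]; exact Finset.sum_congr rfl fun i _ => by ring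
    simp_rw [this]
    have hint : ∀ i ∈ s, Integrable (fun x => c i * (e i x * H x)) μ :=
      fun i hi => ((he i hi).integrable_mul hH).const_mul (c i)
    rw [integral_finsetSum s hint]
    refine Finset.sum_congr rfl fun i hi => ?_
    rw [integral_const_mul, hj i hi, sq]
  have hGF' := key F hF fun _ _ => rfl
  have hGG' := key G hGm hGG
  have h3 : 0 ≤ ∫ x, (F x - G x) ^ 2 ∂μ := integral_nonneg fun x => sq_nonneg _
  have h4 : ∫ x, (F x - G x) ^ 2 ∂μ
      = ∫ x, F x ^ 2 ∂μ - 2 * ∫ x, G x * F x ∂μ + ∫ x, G x * G x ∂μ := by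
    have iF : Integrable (fun x => F x ^ 2) μ := hF.integrable_sq
    have iGF : Integrable (fun x => 2 * (G x * F x)) μ := (hGm.integrable_mul hF).const_mul 2
    have iGG : Integrable (fun x => G x * G x) μ := hGm.integrable_mul hGm
    have iS : Integrable (fun x => F x ^ 2 - 2 * (G x * F x)) μ := iF.sub iGF
    rw [← integral_const_mul, ← integral_sub iF iGF, ← integral_add iS iGG]
    exact integral_congr_ae (.of_forall fun x => by ring)
  linarith

/-- The half-open dyadic interval `[m 2⁻ⁿ, (m + 1) 2⁻ⁿ)`. -/
def dyadicIco (n m : ℕ) : Set ℝ := Set.Ico ((m : ℝ) / 2 ^ n) (((m : ℝ) + 1) / 2 ^ n)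

theorem measurableSet_dyadicIco (n m : ℕ) : MeasurableSet (dyadicIco n m) := measurableSet_Ico

theorem volume_real_dyadicIco (n m : ℕ) : volume.real (dyadicIco n m) = (2 ^ n)⁻¹ := by
  rw [dyadicIco, Real.volume_real_Ico_of_le (by gcongr; linarith)]
  ring

theorem integrable_indicator_dyadicIco (n m : ℕ) :
    Integrable ((dyadicIco n m).indicator (1 : ℝ → ℝ)) :=
  (integrable_indicator_iff (measurableSet_dyadicIco n m)).2
    (integrableOn_const (by simp [dyadicIco]))

theorem integral_indicator_dyadicIco (n m : ℕ) :
    ∫ x, (dyadicIco n m).indicator (1 : ℝ → ℝ) x = (2 ^ n)⁻¹ := by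
  rw [integral_indicator_one (measurableSet_dyadicIco n m), volume_real_dyadicIco]

/-- Dyadic intervals are nested or disjoint. -/
theorem dyadicIco_subset_or_disjoint {n q : ℕ} (hnq : n ≤ q) (m K : ℕ) :
    dyadicIco q K ⊆ dyadicIco n m ∨ Disjoint (dyadicIco q K) (dyadicIco n m) := by
  obtain ⟨t, rfl⟩ := Nat.exists_eq_add_of_le hnq
  have scale : ∀ y : ℝ, y / 2 ^ n = y * 2 ^ t / 2 ^ (n + t) := fun y => by
    rw [pow_add]; field_simp
  have hpos : (0 : ℝ) < 2 ^ (n + t) := by positivity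
  simp only [dyadicIco, scale, Set.disjoint_left]
  rcases lt_or_ge K (m * 2 ^ t) with h | h
  · right
    rintro x ⟨_, hx⟩ ⟨hx', _⟩
    have h' : (K : ℝ) + 1 ≤ m * 2 ^ t := by exact_mod_cast h
    exact absurd (hx.trans_le (div_le_div_of_nonneg_right h' hpos.le)) (not_lt.2 hx')
  rcases lt_or_ge K ((m + 1) * 2 ^ t) with h2 | h2
  · left
    have h' : (m : ℝ) * 2 ^ t ≤ K := by exact_mod_cast h
    have h2' : (K : ℝ) + 1 ≤ (m + 1) * 2 ^ t := by exact_mod_cast h2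
    exact Set.Ico_subset_Ico (div_le_div_of_nonneg_right h' hpos.le)
      (div_le_div_of_nonneg_right h2' hpos.le)
  · right
    rintro x ⟨hx, _⟩ ⟨_, hx'⟩
    have h' : ((m : ℝ) + 1) * 2 ^ t ≤ K := by exact_mod_cast h2
    exact absurd (hx'.trans_le (div_le_div_of_nonneg_right h' hpos.le)) (not_lt.2 hx)

theorem disjoint_dyadicIco (n : ℕ) {m K : ℕ} (h : m ≠ K) :
    Disjoint (dyadicIco n m) (dyadicIco n K) := by
  have hpos : (0 : ℝ) < 2 ^ n := by positivity
  rw [Set.disjoint_left]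
  rintro x ⟨h1, h2⟩ ⟨h3, h4⟩
  rw [div_le_iff₀ hpos] at h1 h3
  rw [lt_div_iff₀ hpos] at h2 h4
  have a : (m : ℝ) < K + 1 := h1.trans_lt h4
  have b : (K : ℝ) < m + 1 := h3.trans_lt h2
  norm_cast at a b
  omega

theorem dyadicIco_child_subset (n m : ℕ) {c : ℕ} (hc : c < 2) :
    dyadicIco (n + 1) (2 * m + c) ⊆ dyadicIco n m := by
  have hc0 : (0 : ℝ) ≤ c := c.cast_nonneg
  have hc1 : (c : ℝ) ≤ 1 := by exact_mod_cast Nat.le_of_lt_succ hc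
  refine Set.Ico_subset_Ico ?_ ?_ <;>
  · rw [div_le_div_iff₀ (by positivity) (by positivity), pow_succ]
    push_cast
    nlinarith [show (0 : ℝ) < 2 ^ n by positivity]

theorem dyadicIco_subset_Ico {n m : ℕ} (h : m < 2 ^ n) : dyadicIco n m ⊆ Set.Ico 0 1 := by
  refine Set.Ico_subset_Ico (by positivity) ?_
  rw [div_le_one (by positivity)]
  exact_mod_cast h

/-- Translating by the length of a dyadic interval maps it to its right neighbour. -/
theorem add_mem_dyadicIco_succ {n m : ℕ} {x : ℝ} :
    x + (2 ^ n)⁻¹ ∈ dyadicIco n (m + 1) ↔ x ∈ dyadicIco n m := by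
  have e1 : (((m + 1 : ℕ) : ℝ)) / 2 ^ n = m / 2 ^ n + (2 ^ n)⁻¹ := by push_cast; ring
  have e2 : (((m + 1 : ℕ) : ℝ) + 1) / 2 ^ n = (m + 1) / 2 ^ n + (2 ^ n)⁻¹ := by push_cast; ring
  rw [dyadicIco, dyadicIco, Set.mem_Ico, Set.mem_Ico, e1, e2]
  simp

/-- On `[0, 1)` the intervals `dyadicI` and `dyadicIco` agree. -/
theorem mem_dyadicI_iff {n m : ℕ} {x : ℝ} (hx : x < 1) :
    x ∈ dyadicI n m ↔ x ∈ dyadicIco n m := by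
  unfold dyadicI dyadicIco
  split_ifs with h
  · have : ((m : ℝ) + 1) / 2 ^ n = 1 := by
      rw [div_eq_one_iff_eq (by positivity)]; exact_mod_cast h
    rw [this]
    exact ⟨fun h => ⟨h.1, hx⟩, fun h => ⟨h.1, hx.le⟩⟩
  · rfl

/-- The position `κ` of the index `a = 2^λ + κ` within its level. -/
def haarPos (a : ℕ) : ℕ := a - 2 ^ Nat.log 2 a

theorem haarPos_lt {a : ℕ} (ha : a ≠ 0) : haarPos a < 2 ^ Nat.log 2 a := by
  have h1 := Nat.pow_log_le_self 2 ha
  have h2 := Nat.lt_pow_succ_log_self (b := 2) (by norm_num) a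
  rw [haarPos]
  omega

theorem haarPos_add {a : ℕ} (ha : a ≠ 0) : haarPos a + 2 ^ Nat.log 2 a = a :=
  Nat.sub_add_cancel (Nat.pow_log_le_self 2 ha)

/-- The left half of the support of the Haar function with index `a ≠ 0`. -/
def haarL (a : ℕ) : Set ℝ := dyadicIco (Nat.log 2 a + 1) (2 * haarPos a)

/-- The right half of the support of the Haar function with index `a ≠ 0`. -/
def haarR (a : ℕ) : Set ℝ := dyadicIco (Nat.log 2 a + 1) (2 * haarPos a + 1)

theorem haarL_subset (a : ℕ) : haarL a ⊆ dyadicIco (Nat.log 2 a) (haarPos a) :=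
  dyadicIco_child_subset _ _ (c := 0) (by norm_num)

theorem haarR_subset (a : ℕ) : haarR a ⊆ dyadicIco (Nat.log 2 a) (haarPos a) :=
  dyadicIco_child_subset _ _ (c := 1) (by norm_num)

theorem haarL_subset_Ico {a : ℕ} (ha : a ≠ 0) : haarL a ⊆ Set.Ico 0 1 :=
  (haarL_subset a).trans (dyadicIco_subset_Ico (haarPos_lt ha))

theorem haarR_subset_Ico {a : ℕ} (ha : a ≠ 0) : haarR a ⊆ Set.Ico 0 1 :=
  (haarR_subset a).trans (dyadicIco_subset_Ico (haarPos_lt ha))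

theorem disjoint_haarL_haarR (a : ℕ) : Disjoint (haarL a) (haarR a) :=
  disjoint_dyadicIco _ (by omega)

/-- The Haar functions built from half-open intervals, extended by zero to the real line. -/
def haarIco (a : ℕ) (x : ℝ) : ℝ :=
  if a = 0 then (Set.Ico (0 : ℝ) 1).indicator 1 x
  else √(2 ^ Nat.log 2 a) * ((haarR a).indicator 1 x - (haarL a).indicator 1 x)

theorem haarIco_of_ne {a : ℕ} (ha : a ≠ 0) (x : ℝ) :
    haarIco a x = √(2 ^ Nat.log 2 a) * ((haarR a).indicator 1 x - (haarL a).indicator 1 x) :=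
  if_neg ha

theorem haar1_eq_haarIco (a : ℕ) {x : ℝ} (hx : x ∈ Set.Ico (0 : ℝ) 1) :
    haar1 a x = haarIco a x := by
  unfold haar1 haarIco
  split_ifs
  · simp [hx, Set.Ico_subset_Icc_self hx]
  · have (n m : ℕ) : (dyadicI n m).indicator (1 : ℝ → ℝ) x = (dyadicIco n m).indicator 1 x := by
      by_cases h : x ∈ dyadicIco n m
      · simp [h, (mem_dyadicI_iff hx.2).2 h]
      · simp [h, mt (mem_dyadicI_iff hx.2).1 h]
    simp only [this, haarL, haarR, haarPos]

theorem measurable_haarIco (a : ℕ) : Measurable (haarIco a) := by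
  unfold haarIco
  split_ifs
  · exact measurable_one.indicator measurableSet_Ico
  · exact ((measurable_one.indicator (measurableSet_dyadicIco _ _)).sub
      (measurable_one.indicator (measurableSet_dyadicIco _ _))).const_mul _

theorem integral_haarIco {a : ℕ} (ha : a ≠ 0) : ∫ x, haarIco a x = 0 := by
  simp_rw [haarIco_of_ne ha]
  rw [integral_const_mul, haarL, haarR, integral_sub (integrable_indicator_dyadicIco _ _)
    (integrable_indicator_dyadicIco _ _), integral_indicator_dyadicIco,
    integral_indicator_dyadicIco, sub_self, mul_zero]

theorem haarIco_mul_self {a : ℕ} (ha : a ≠ 0) (x : ℝ) :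
    haarIco a x * haarIco a x
      = 2 ^ Nat.log 2 a * ((haarR a).indicator 1 x + (haarL a).indicator 1 x) := by
  rw [haarIco_of_ne ha]
  have hs : √((2 : ℝ) ^ Nat.log 2 a) * √(2 ^ Nat.log 2 a) = 2 ^ Nat.log 2 a :=
    Real.mul_self_sqrt (by positivity)
  have hd : (haarR a).indicator (1 : ℝ → ℝ) x * (haarL a).indicator 1 x = 0 := by
    by_cases h : x ∈ haarL a
    · simp [Set.disjoint_left.1 (disjoint_haarL_haarR a) h]
    · simp [h]
  have hi : ∀ s : Set ℝ, s.indicator (1 : ℝ → ℝ) x * s.indicator 1 x = s.indicator 1 x :=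
    fun s => by by_cases h : x ∈ s <;> simp [h]
  linear_combination ((haarR a).indicator 1 x - (haarL a).indicator 1 x) ^ 2 * hs
    + 2 ^ Nat.log 2 a * (hi (haarR a) + hi (haarL a) - 2 * hd)

theorem integral_haarIco_mul_self (a : ℕ) : ∫ x, haarIco a x * haarIco a x = 1 := by
  by_cases ha : a = 0
  · have : ∀ x, haarIco a x * haarIco a x = (Set.Ico (0 : ℝ) 1).indicator 1 x := fun x => by
      by_cases h : x ∈ Set.Ico (0 : ℝ) 1 <;> simp [haarIco, ha, h]
    simp_rw [this]
    rw [integral_indicator_one measurableSet_Ico]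
    simp
  · simp_rw [haarIco_mul_self ha]
    rw [integral_const_mul, haarL, haarR, integral_add (integrable_indicator_dyadicIco _ _)
      (integrable_indicator_dyadicIco _ _), integral_indicator_dyadicIco,
      integral_indicator_dyadicIco, pow_succ]
    field_simp
    norm_num

/-- A Haar function is constant on the support of any Haar function with larger index. -/
theorem exists_haarIco_eq_const {a b : ℕ} (hab : b < a) :
    ∃ c : ℝ, ∀ x ∈ dyadicIco (Nat.log 2 a) (haarPos a), haarIco b x = c := by
  have ha : a ≠ 0 := by omega
  by_cases hb : b = 0
  · refine ⟨1, fun x hx => ?_⟩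
    simp [haarIco, hb, dyadicIco_subset_Ico (haarPos_lt ha) hx]
  have const : ∀ s : Set ℝ, (dyadicIco (Nat.log 2 a) (haarPos a) ⊆ s ∨
      Disjoint (dyadicIco (Nat.log 2 a) (haarPos a)) s) → ∃ c : ℝ,
      ∀ x ∈ dyadicIco (Nat.log 2 a) (haarPos a), s.indicator 1 x = c := by
    rintro s (h | h)
    · exact ⟨1, fun x hx => by simp [h hx]⟩
    · exact ⟨0, fun x hx => by simp [Set.disjoint_left.1 h hx]⟩
  have hhalf : ∀ s : Set ℝ, s = haarL b ∨ s = haarR b →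
      (dyadicIco (Nat.log 2 a) (haarPos a) ⊆ s ∨
        Disjoint (dyadicIco (Nat.log 2 a) (haarPos a)) s) := by
    intro s hs
    rcases (Nat.log_mono_right hab.le : Nat.log 2 b ≤ Nat.log 2 a).lt_or_eq with hl | hl
    · rcases hs with rfl | rfl <;> exact dyadicIco_subset_or_disjoint hl _ _
    · have hne : haarPos a ≠ haarPos b := fun h => by
        have h1 := haarPos_add ha
        have h2 := haarPos_add hb
        rw [hl, ← h, h1] at h2
        omega
      have hsub : s ⊆ dyadicIco (Nat.log 2 a) (haarPos b) := by
        rw [← hl]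
        rcases hs with rfl | rfl
        exacts [haarL_subset b, haarR_subset b]
      exact .inr ((disjoint_dyadicIco _ hne).mono_right hsub)
  obtain ⟨cL, hL⟩ := const _ (hhalf _ (.inl rfl))
  obtain ⟨cR, hR⟩ := const _ (hhalf _ (.inr rfl))
  exact ⟨√(2 ^ Nat.log 2 b) * (cR - cL), fun x hx => by
    rw [haarIco_of_ne hb, hL x hx, hR x hx]⟩

theorem integral_haarIco_mul_of_lt {a b : ℕ} (hab : b < a) :
    ∫ x, haarIco a x * haarIco b x = 0 := by
  obtain ⟨c, hc⟩ := exists_haarIco_eq_const hab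
  have ha : a ≠ 0 := by omega
  have : ∀ x, haarIco a x * haarIco b x = haarIco a x * c := by
    intro x
    by_cases hx : x ∈ dyadicIco (Nat.log 2 a) (haarPos a)
    · rw [hc x hx]
    · have hL : x ∉ haarL a := fun h => hx (haarL_subset a h)
      have hR : x ∉ haarR a := fun h => hx (haarR_subset a h)
      simp [haarIco_of_ne ha, hL, hR]
  simp_rw [this]
  rw [integral_mul_const, integral_haarIco ha, zero_mul]

theorem integral_haarIco_mul (a b : ℕ) :
    ∫ x, haarIco a x * haarIco b x = if a = b then 1 else 0 := by
  rcases lt_trichotomy a b with h | rfl | h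
  · simp_rw [if_neg h.ne, mul_comm (haarIco a _)]
    exact integral_haarIco_mul_of_lt h
  · simpa using integral_haarIco_mul_self a
  · rw [if_neg h.ne', integral_haarIco_mul_of_lt h]

theorem memLp_prod_of_integral_ne_zero {d : ℕ} (u : Fin d → ℝ → ℝ) (hu : ∀ j, Measurable (u j))
    (h : ∀ j, ∫ x, u j x * u j x ≠ 0) : MemLp (fun x : Fin d → ℝ => ∏ j, u j (x j)) 2 := by
  have hm : Measurable fun x : Fin d → ℝ => ∏ j, u j (x j) :=
    Finset.measurable_prod _ fun j _ => (hu j).comp (measurable_pi_apply j)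
  rw [memLp_two_iff_integrable_sq hm.aestronglyMeasurable]
  simp_rw [sq, ← Finset.prod_mul_distrib]
  exact Integrable.fintype_prod (f := fun j x => u j x * u j x) fun j => by
    by_contra hj
    exact h j (integral_undef hj)

/-- Bessel's inequality for a tensor-product orthonormal system on `ℝ^d`. -/
theorem sum_sq_integral_prod_mul_le {d : ℕ} (S : Finset (Fin d → ℕ)) (u : Fin d → ℕ → ℝ → ℝ)
    (hu : ∀ j a, Measurable (u j a))
    (ho : ∀ α ∈ S, ∀ β ∈ S, ∀ j,
      ∫ x, u j (α j) x * u j (β j) x = if α j = β j then 1 else 0)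
    (F : (Fin d → ℝ) → ℝ) (hF : MemLp F 2) :
    ∑ α ∈ S, (∫ x : Fin d → ℝ, (∏ j, u j (α j) (x j)) * F x) ^ 2 ≤ ∫ x, F x ^ 2 := by
  have hmem : ∀ α ∈ S, MemLp (fun x : Fin d → ℝ => ∏ j, u j (α j) (x j)) 2 volume := by
    intro α hα
    refine memLp_prod_of_integral_ne_zero (fun j => u j (α j)) (fun j => hu j _) fun j => ?_
    rw [ho α hα α hα j, if_pos rfl]
    exact one_ne_zero
  have hprod (α β : Fin d → ℕ) : ∫ x : Fin d → ℝ, (∏ j, u j (α j) (x j)) *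
      ∏ j, u j (β j) (x j) = ∏ j, ∫ x, u j (α j) x * u j (β j) x := by
    simp_rw [← Finset.prod_mul_distrib]
    exact integral_fintype_prod_volume_eq_prod (fun j x => u j (α j) x * u j (β j) x)
  refine sum_sq_integral_mul_le (Ω := Fin d → ℝ) (μ := volume) S (fun α x => ∏ j, u j (α j) (x j)) F hmem hF
    (fun α hα => ?_) fun α hα β hβ h => ?_
  · rw [hprod]
    exact Finset.prod_eq_one fun j _ => by rw [ho α hα α hα j, if_pos rfl]
  · obtain ⟨j, hj⟩ := Function.ne_iff.1 h
    rw [hprod]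
    exact Finset.prod_eq_zero (Finset.mem_univ j) (by rw [ho α hα β hβ j, if_neg hj])

/-- The half-open unit cube `[0,1)^d`. -/
def cubeIco (d : ℕ) : Set (Fin d → ℝ) := Set.univ.pi fun _ => Set.Ico 0 1

theorem mem_cubeIco {d : ℕ} {x : Fin d → ℝ} : x ∈ cubeIco d ↔ ∀ j, x j ∈ Set.Ico (0 : ℝ) 1 := by
  simp [cubeIco]

theorem cubeIco_subset_unitCube (d : ℕ) : cubeIco d ⊆ unitCube d := fun _ hx =>
  ⟨fun j => (mem_cubeIco.1 hx j).1, fun j => (mem_cubeIco.1 hx j).2.le⟩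

theorem measurableSet_cubeIco (d : ℕ) : MeasurableSet (cubeIco d) :=
  MeasurableSet.univ_pi fun _ => measurableSet_Ico

theorem volume_cubeIco (d : ℕ) : volume (cubeIco d) = 1 := by
  simp [cubeIco, volume_pi_pi]

theorem wcoef_eq_integral_haarIco {d : ℕ} (f : (Fin d → ℝ) → ℝ) (α : Fin d → ℕ) :
    wcoef f α = ∫ x, (∏ j, haarIco (α j) (x j)) * (cubeIco d).indicator f x := by
  have hae : (cubeIco d : Set (Fin d → ℝ)) =ᵐ[volume] unitCube d := Measure.univ_pi_Ico_ae_eq_Icc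
  rw [wcoef, ← setIntegral_congr_set hae, ← integral_indicator (measurableSet_cubeIco d)]
  refine integral_congr_ae (.of_forall fun x => ?_)
  by_cases hx : x ∈ cubeIco d
  · simp only [Set.indicator_of_mem hx, haar]
    congr 1
    exact Finset.prod_congr rfl fun j _ => haar1_eq_haarIco _ (mem_cubeIco.1 hx j)
  · simp [hx]

/-- A monotone function on the cube is a.e. measurable there. -/
theorem aemeasurable_of_mem_FMon {d : ℕ} {f : (Fin d → ℝ) → ℝ} (hf : f ∈ FMon d) :
    AEMeasurable f (volume.restrict (cubeIco d)) := by
  rw [← aemeasurable_indicator_iff (measurableSet_cubeIco d)]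
  refine NullMeasurable.aemeasurable ?_
  refine measurable_of_Ici (δ := NullMeasurableSpace (Fin d → ℝ) volume) fun t => ?_
  have hset : NullMeasurableSet {x | x ∈ cubeIco d ∧ t ≤ f x} := by
    refine Set.OrdConnected.nullMeasurableSet ⟨?_⟩
    rintro x ⟨hx, hxt⟩ y ⟨hy, _⟩ z ⟨hxz, hzy⟩
    have hz : z ∈ cubeIco d := mem_cubeIco.2 fun j =>
      ⟨(mem_cubeIco.1 hx j).1.trans (hxz j), (hzy j).trans_lt (mem_cubeIco.1 hy j).2⟩
    exact ⟨hz, hxt.trans (hf.2 x (cubeIco_subset_unitCube d hx) z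
      (cubeIco_subset_unitCube d hz) hxz)⟩
  have hpre : (cubeIco d).indicator f ⁻¹' Set.Ici t
      = {x | x ∈ cubeIco d ∧ t ≤ f x} ∪ ((cubeIco d)ᶜ ∩ {_x | t ≤ 0}) := by
    ext x
    by_cases hx : x ∈ cubeIco d <;> simp [hx]
  suffices h : NullMeasurableSet ((cubeIco d).indicator f ⁻¹' Set.Ici t) from h
  rw [hpre]
  exact hset.union ((measurableSet_cubeIco d).compl.inter (.const _)).nullMeasurableSet

theorem memLp_indicator_of_mem_FMon {d : ℕ} {f : (Fin d → ℝ) → ℝ} (hf : f ∈ FMon d)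
    (p : ℝ≥0∞) : MemLp ((cubeIco d).indicator f) p := by
  rw [memLp_indicator_iff_restrict (measurableSet_cubeIco d)]
  have : IsFiniteMeasure (volume.restrict (cubeIco d)) :=
    ⟨by simp [volume_cubeIco]⟩
  refine MemLp.of_bound (aemeasurable_of_mem_FMon hf).aestronglyMeasurable 1 ?_
  refine (ae_restrict_iff' (measurableSet_cubeIco d)).2 (.of_forall fun x hx => ?_)
  exact abs_le.2 (hf.1 x (cubeIco_subset_unitCube d hx))

theorem sum_sq_wcoef_le_one {d : ℕ} {f : (Fin d → ℝ) → ℝ} (hf : f ∈ FMon d)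
    (S : Finset (Fin d → ℕ)) : ∑ α ∈ S, wcoef f α ^ 2 ≤ 1 := by
  have hF := memLp_indicator_of_mem_FMon hf 2
  calc ∑ α ∈ S, wcoef f α ^ 2
      ≤ ∫ x, (cubeIco d).indicator f x ^ 2 := by
        simp_rw [wcoef_eq_integral_haarIco]
        exact sum_sq_integral_prod_mul_le S (fun _ => haarIco) (fun _ => measurable_haarIco)
          (fun α _ β _ j => integral_haarIco_mul _ _) _ hF
    _ ≤ ∫ x, (cubeIco d).indicator 1 x := by
        refine integral_mono hF.integrable_sq
          ((integrable_indicator_iff (measurableSet_cubeIco d)).2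
            (integrableOn_const (by simp [volume_cubeIco]))) fun x => ?_
        by_cases hx : x ∈ cubeIco d
        · simpa [hx] using abs_le.2 (hf.1 x (cubeIco_subset_unitCube d hx))
        · simp [hx]
    _ = 1 := by
        rw [integral_indicator_one (measurableSet_cubeIco d), measureReal_def, volume_cubeIco]
        simp

/-- The distance between the two halves of the support of the Haar function with index `a`. -/
def haarStep (a : ℕ) : ℝ := (2 ^ (Nat.log 2 a + 1))⁻¹

theorem haarStep_nonneg (a : ℕ) : 0 ≤ haarStep a := by unfold haarStep; positivity

theorem add_haarStep_mem_haarR {a : ℕ} {x : ℝ} : x + haarStep a ∈ haarR a ↔ x ∈ haarL a :=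
  add_mem_dyadicIco_succ

theorem sqrt_pow_pos (n : ℕ) : 0 < √((2 : ℝ) ^ n) := Real.sqrt_pos.2 (by positivity)

/-- The normalised indicator of the left half of the support of a Haar function. -/
def haarHalf (a : ℕ) (x : ℝ) : ℝ := √2 * √(2 ^ Nat.log 2 a) * (haarL a).indicator 1 x

theorem measurable_haarHalf (a : ℕ) : Measurable (haarHalf a) :=
  (measurable_one.indicator (measurableSet_dyadicIco _ _)).const_mul _

theorem integral_haarHalf_mul_self (a : ℕ) : ∫ x, haarHalf a x * haarHalf a x = 1 := by
  have hs : √((2 : ℝ) ^ Nat.log 2 a) * √(2 ^ Nat.log 2 a) = 2 ^ Nat.log 2 a :=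
    Real.mul_self_sqrt (by positivity)
  have h2 : √(2 : ℝ) * √2 = 2 := Real.mul_self_sqrt (by norm_num)
  have (x : ℝ) : haarHalf a x * haarHalf a x
      = 2 ^ (Nat.log 2 a + 1) * (haarL a).indicator 1 x := by
    by_cases h : x ∈ haarL a
    · simp only [haarHalf, h, Set.indicator_of_mem, Pi.one_apply, mul_one, pow_succ]
      linear_combination √2 * √2 * hs + 2 ^ Nat.log 2 a * h2
    · simp [haarHalf, h]
  simp_rw [this]
  rw [integral_const_mul, haarL, integral_indicator_dyadicIco,
    mul_inv_cancel₀ (by positivity)]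

/-- The Haar system with the `j`-th factor replaced by `haarHalf`. -/
def haarHalfSystem {d : ℕ} (j : Fin d) (i : Fin d) : ℕ → ℝ → ℝ :=
  if i = j then haarHalf else haarIco

theorem prod_haarHalfSystem {d : ℕ} (j : Fin d) (α : Fin d → ℕ) (x : Fin d → ℝ) :
    ∏ i, haarHalfSystem j i (α i) (x i)
      = haarHalf (α j) (x j) * ∏ i ∈ Finset.univ.erase j, haarIco (α i) (x i) := by
  rw [← Finset.mul_prod_erase _ _ (Finset.mem_univ j), haarHalfSystem, if_pos rfl]
  congr 1
  refine Finset.prod_congr rfl fun i hi => ?_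
  rw [haarHalfSystem, if_neg (Finset.ne_of_mem_erase hi)]

theorem measurable_haarHalfSystem {d : ℕ} (j i : Fin d) (a : ℕ) :
    Measurable (haarHalfSystem j i a) := by
  unfold haarHalfSystem
  split_ifs
  exacts [measurable_haarHalf a, measurable_haarIco a]

theorem integral_haarHalfSystem_mul {d : ℕ} (j i : Fin d) {α β : Fin d → ℕ} (h : α j = β j) :
    ∫ x, haarHalfSystem j i (α i) x * haarHalfSystem j i (β i) x
      = if α i = β i then 1 else 0 := by
  unfold haarHalfSystem
  split_ifs with hij hαβ hαβ
  · rw [hαβ, integral_haarHalf_mul_self]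
  · exact absurd (hij ▸ h) hαβ
  · rw [hαβ, integral_haarIco_mul, if_pos rfl]
  · rw [integral_haarIco_mul, if_neg hαβ]

/-- The (scaled) increment of `F` in direction `j` between the halves of the support of the
Haar function with index `a`. -/
def haarDiff {d : ℕ} (j : Fin d) (a : ℕ) (F : (Fin d → ℝ) → ℝ) (x : Fin d → ℝ) : ℝ :=
  (√2)⁻¹ * (haarL a).indicator 1 (x j) * (F (x + Pi.single j (haarStep a)) - F x)

theorem memLp_haarDiff {d : ℕ} (j : Fin d) (a : ℕ) {F : (Fin d → ℝ) → ℝ} {p : ℝ≥0∞}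
    (hF : MemLp F p) : MemLp (haarDiff j a F) p := by
  have hsub : MemLp (fun x => F (x + Pi.single j (haarStep a)) - F x) p :=
    (hF.comp_measurePreserving (measurePreserving_add_right volume _)).sub hF
  have hm : MeasurableSet {x : Fin d → ℝ | x j ∈ haarL a} :=
    measurable_pi_apply j (measurableSet_dyadicIco _ _)
  refine ((hsub.indicator hm).const_mul (√2)⁻¹).ae_eq (.of_forall fun x => ?_)
  by_cases hx : x j ∈ haarL a <;> simp [haarDiff, hx]

/-- A Haar coefficient is the coefficient of an increment in any active variable. -/
theorem integral_haarIco_mul_eq_haarHalfSystem {d : ℕ} (j : Fin d) {α : Fin d → ℕ}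
    (hα : α j ≠ 0) {F : (Fin d → ℝ) → ℝ} (hF : MemLp F 2) :
    ∫ x, (∏ i, haarIco (α i) (x i)) * F x
      = ∫ x, (∏ i, haarHalfSystem j i (α i) (x i)) * haarDiff j (α j) F x := by
  set s : Fin d → ℝ := Pi.single j (haarStep (α j)) with hs
  set P : (Fin d → ℝ) → ℝ := fun x => ∏ i ∈ Finset.univ.erase j, haarIco (α i) (x i) with hP
  set c : ℝ := √(2 ^ Nat.log 2 (α j)) with hc
  have hPs (x : Fin d → ℝ) : P (x + s) = P x := by
    refine Finset.prod_congr rfl fun i hi => ?_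
    simp [hs, Finset.ne_of_mem_erase hi]
  have h2 : (√(2 : ℝ)) * (√2)⁻¹ = 1 := mul_inv_cancel₀ (by positivity)
  set A : (Fin d → ℝ) → ℝ := fun x => c * (haarR (α j)).indicator 1 (x j) * P x * F x with hA
  set B : (Fin d → ℝ) → ℝ := fun x => c * (haarL (α j)).indicator 1 (x j) * P x * F x with hB
  have hAB (x : Fin d → ℝ) : (∏ i, haarIco (α i) (x i)) * F x = A x - B x := by
    rw [← Finset.mul_prod_erase _ _ (Finset.mem_univ j), haarIco_of_ne hα]
    simp only [hA, hB, hP, hc]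
    ring
  have hAs (x : Fin d → ℝ) :
      A (x + s) = c * (haarL (α j)).indicator 1 (x j) * P x * F (x + s) := by
    have : (haarR (α j)).indicator (1 : ℝ → ℝ) ((x + s) j)
        = (haarL (α j)).indicator 1 (x j) := by
      have hxs : (x + s) j = x j + haarStep (α j) := by simp [hs]
      rw [hxs]
      by_cases h : x j ∈ haarL (α j)
      · simp [h, add_haarStep_mem_haarR.2 h]
      · simp [h, mt add_haarStep_mem_haarR.1 h]
    simp only [hA, this, hPs]
  have hABs (x : Fin d → ℝ) :
      (∏ i, haarHalfSystem j i (α i) (x i)) * haarDiff j (α j) F x = A (x + s) - B x := by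
    rw [prod_haarHalfSystem, hAs]
    by_cases h : x j ∈ haarL (α j)
    · simp only [haarHalf, haarDiff, h, Set.indicator_of_mem, Pi.one_apply, hB, hs, hP, hc]
      linear_combination c * P x * (F (x + s) - F x) * h2
    · simp [haarHalf, h, hB]
  have hTint : Integrable fun x => A x - B x := by
    simp_rw [← hAB]
    exact (memLp_prod_of_integral_ne_zero (fun i => haarIco (α i))
      (fun i => measurable_haarIco _) (fun i => by simp [integral_haarIco_mul])).integrable_mul hF
  have hBint : Integrable B := by
    have h := ((memLp_prod_of_integral_ne_zero (fun i => haarHalfSystem j i (α i))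
      (fun i => measurable_haarHalfSystem j i _)
      (fun i => by simp [integral_haarHalfSystem_mul])).integrable_mul hF).const_mul (√2)⁻¹
    refine h.congr (.of_forall fun x => ?_)
    simp only [Pi.mul_apply, prod_haarHalfSystem, haarHalf, hB, hP, hc]
    linear_combination c * (haarL (α j)).indicator 1 (x j) * P x * F x * h2
  have hAint : Integrable A := (hTint.add hBint).congr (.of_forall fun x => by simp)
  simp_rw [hAB, hABs]
  rw [integral_sub hAint hBint, integral_sub (hAint.comp_add_right s) hBint,
    integral_add_right_eq_self]

theorem add_single_haarStep_mem_cubeIco {d : ℕ} (j : Fin d) {a : ℕ} (ha : a ≠ 0) {x : Fin d → ℝ}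
    (hx : x j ∈ haarL a) : x + Pi.single j (haarStep a) ∈ cubeIco d ↔ x ∈ cubeIco d := by
  simp only [mem_cubeIco]
  refine forall_congr' fun i => ?_
  by_cases hi : i = j
  · subst hi
    have h1 := haarR_subset_Ico ha (add_haarStep_mem_haarR.2 hx)
    have h2 := haarL_subset_Ico ha hx
    simp only [Pi.add_apply, Pi.single_eq_same, h1, h2]
  · simp [hi]

theorem haarDiff_mem_Icc {d : ℕ} {f : (Fin d → ℝ) → ℝ} (hf : f ∈ FMon d) (j : Fin d) {a : ℕ}
    (ha : a ≠ 0) (x : Fin d → ℝ) :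
    haarDiff j a ((cubeIco d).indicator f) x ∈ Set.Icc 0 √2 := by
  by_cases hx : x j ∈ haarL a
  swap
  · simp [haarDiff, hx]
  by_cases hQ : x ∈ cubeIco d
  swap
  · simp [haarDiff, hQ, mt (add_single_haarStep_mem_cubeIco j ha hx).1 hQ]
  have hQ' := (add_single_haarStep_mem_cubeIco j ha hx).2 hQ
  have hU := cubeIco_subset_unitCube d hQ
  have hU' := cubeIco_subset_unitCube d hQ'
  have hle : x ≤ x + Pi.single j (haarStep a) :=
    le_add_of_nonneg_right (Pi.single_nonneg.2 (haarStep_nonneg a))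
  have h1 := hf.2 x hU _ hU' hle
  have h2 := (hf.1 x hU).1
  have h3 := (hf.1 _ hU').2
  have hs : (√2)⁻¹ * 2 = √2 := by
    rw [inv_mul_eq_div, Real.div_sqrt]
  simp only [haarDiff, hx, hQ, hQ', Set.indicator_of_mem, Pi.one_apply, mul_one]
  refine ⟨mul_nonneg (by positivity) (by linarith), ?_⟩
  calc _ ≤ (√2)⁻¹ * 2 := mul_le_mul_of_nonneg_left (by linarith) (by positivity)
    _ = √2 := hs

theorem wcoef_single_eq {d : ℕ} {f : (Fin d → ℝ) → ℝ} (hf : f ∈ FMon d) (j : Fin d) {a : ℕ}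
    (ha : a ≠ 0) : wcoef f (Pi.single j a)
      = √2 * √(2 ^ Nat.log 2 a) * ∫ x, haarDiff j a ((cubeIco d).indicator f) x := by
  have hj : (Pi.single j a : Fin d → ℕ) j ≠ 0 := by simpa
  rw [wcoef_eq_integral_haarIco, integral_haarIco_mul_eq_haarHalfSystem j hj
    (memLp_indicator_of_mem_FMon hf 2), ← integral_const_mul]
  refine integral_congr_ae (.of_forall fun x => ?_)
  simp only [prod_haarHalfSystem, Pi.single_eq_same]
  by_cases hx : x j ∈ haarL a
  swap
  · simp [haarDiff, hx]
  by_cases hQ : x ∈ cubeIco d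
  swap
  · simp [haarDiff, hQ, mt (add_single_haarStep_mem_cubeIco j ha hx).1 hQ]
  have hP : ∏ i ∈ Finset.univ.erase j, haarIco ((Pi.single j a : Fin d → ℕ) i) (x i) = 1 := by
    refine Finset.prod_eq_one fun i hi => ?_
    simp [Finset.ne_of_mem_erase hi, haarIco, Set.indicator_of_mem (mem_cubeIco.1 hQ i)]
  rw [hP]
  simp [haarHalf, hx]

/-- The energy of the coefficients with a fixed `j`-th index is controlled by the coefficient
in which only the variable `j` is active. -/
theorem sum_sq_wcoef_le_wcoef_single {d : ℕ} {f : (Fin d → ℝ) → ℝ} (hf : f ∈ FMon d) (j : Fin d)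
    {a : ℕ} (ha : a ≠ 0) (S : Finset (Fin d → ℕ)) (hS : ∀ α ∈ S, α j = a) :
    ∑ α ∈ S, wcoef f α ^ 2 ≤ wcoef f (Pi.single j a) * (√(2 ^ Nat.log 2 a))⁻¹ := by
  have hF := memLp_indicator_of_mem_FMon hf 2
  have hD := memLp_haarDiff j a hF
  have hDint : Integrable (haarDiff j a ((cubeIco d).indicator f)) :=
    memLp_one_iff_integrable.1 (memLp_haarDiff j a (memLp_indicator_of_mem_FMon hf 1))
  calc ∑ α ∈ S, wcoef f α ^ 2
      = ∑ α ∈ S, (∫ x, (∏ i, haarHalfSystem j i (α i) (x i))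
          * haarDiff j a ((cubeIco d).indicator f) x) ^ 2 := by
        refine Finset.sum_congr rfl fun α hα => ?_
        rw [wcoef_eq_integral_haarIco, integral_haarIco_mul_eq_haarHalfSystem j
          (by rw [hS α hα]; exact ha) hF, hS α hα]
    _ ≤ ∫ x, haarDiff j a ((cubeIco d).indicator f) x ^ 2 :=
        sum_sq_integral_prod_mul_le S (haarHalfSystem j) (measurable_haarHalfSystem j)
          (fun α hα β hβ i => integral_haarHalfSystem_mul j i ((hS α hα).trans (hS β hβ).symm))
          _ hD
    _ ≤ ∫ x, √2 * haarDiff j a ((cubeIco d).indicator f) x := by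
        refine integral_mono hD.integrable_sq (hDint.const_mul _) fun x => ?_
        have h := haarDiff_mem_Icc hf j ha x
        rw [sq]
        exact mul_le_mul_of_nonneg_right h.2 h.1
    _ = wcoef f (Pi.single j a) * (√(2 ^ Nat.log 2 a))⁻¹ := by
        have := sqrt_pow_pos (Nat.log 2 a)
        rw [wcoef_single_eq hf j ha, integral_const_mul]
        field_simp

theorem sum_Ico_inv_two_pow_log (r : ℕ) :
    ∑ a ∈ Finset.Ico 1 (2 ^ r), ((2 : ℝ) ^ Nat.log 2 a)⁻¹ = r := by
  induction r with
  | zero => simp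
  | succ r ih =>
    rw [← Finset.sum_Ico_consecutive _ (Nat.one_le_two_pow (n := r))
      (Nat.pow_le_pow_right two_pos r.le_succ), ih]
    have : ∀ a ∈ Finset.Ico (2 ^ r) (2 ^ (r + 1)), ((2 : ℝ) ^ Nat.log 2 a)⁻¹ = (2 ^ r)⁻¹ := by
      intro a ha
      rw [Finset.mem_Ico] at ha
      rw [Nat.log_eq_of_pow_le_of_lt_pow ha.1 ha.2]
    rw [Finset.sum_congr rfl this, Finset.sum_const, Nat.card_Ico, pow_succ, mul_two,
      Nat.add_sub_cancel, nsmul_eq_mul]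
    push_cast
    rw [mul_inv_cancel₀ (by positivity)]

theorem sum_wcoef_single_le {d : ℕ} (r : ℕ) {f : (Fin d → ℝ) → ℝ} (hf : f ∈ FMon d) :
    ∑ j, ∑ a ∈ Finset.Ico 1 (2 ^ r), wcoef f (Pi.single j a) * (√(2 ^ Nat.log 2 a))⁻¹
      ≤ √(d * r) := by
  rw [← Finset.sum_product']
  set T : Finset (Fin d × ℕ) := Finset.univ ×ˢ Finset.Ico 1 (2 ^ r) with hT
  have hinj : Set.InjOn (fun p : Fin d × ℕ => (Pi.single p.1 p.2 : Fin d → ℕ)) T := by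
    rintro ⟨i, a⟩ hp ⟨j, b⟩ - h
    have ha : a ≠ 0 := by
      simp only [hT, Finset.coe_product, Set.mem_prod, Finset.mem_coe, Finset.mem_Ico] at hp
      omega
    have h1 : a = (Pi.single j b : Fin d → ℕ) i := by simpa using congrFun h i
    obtain rfl : i = j := by
      by_contra hij
      exact ha (by simpa [hij] using h1)
    simpa using h1
  have hw : ∑ p ∈ T, wcoef f (Pi.single p.1 p.2) ^ 2 ≤ 1 := by
    rw [← Finset.sum_image (f := fun α => wcoef f α ^ 2) hinj]
    exact sum_sq_wcoef_le_one hf _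
  have hr : ∑ p ∈ T, ((√((2 : ℝ) ^ Nat.log 2 p.2))⁻¹) ^ 2 = d * r := by
    rw [hT, Finset.sum_product]
    simp_rw [inv_pow, Real.sq_sqrt (show (0 : ℝ) ≤ 2 ^ _ by positivity)]
    simp [sum_Ico_inv_two_pow_log]
  refine (Real.sum_mul_le_sqrt_mul_sqrt T _ _).trans ?_
  rw [hr]
  exact mul_le_of_le_one_left (Real.sqrt_nonneg _) (Real.sqrt_le_one.2 hw)

theorem sum_activeCount_mul_sq_wcoef_le {d : ℕ} (r : ℕ) {f : (Fin d → ℝ) → ℝ} (hf : f ∈ FMon d)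
    (S : Finset (Fin d → ℕ)) (hS : ∀ α ∈ S, ∀ j, α j < 2 ^ r) :
    ∑ α ∈ S, (activeCount α : ℝ) * wcoef f α ^ 2 ≤ √(d * r) := by
  have hcount (α : Fin d → ℕ) :
      (activeCount α : ℝ) * wcoef f α ^ 2 = ∑ j, if α j ≠ 0 then wcoef f α ^ 2 else 0 := by
    rw [← Finset.sum_filter, Finset.sum_const, nsmul_eq_mul, activeCount]
  simp_rw [hcount]
  rw [Finset.sum_comm]
  refine (Finset.sum_le_sum fun j _ => ?_).trans (sum_wcoef_single_le r hf)
  rw [← Finset.sum_filter, ← Finset.sum_fiberwise_of_maps_to (t := Finset.Ico 1 (2 ^ r))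
    (g := fun α => α j) fun α hα => ?_]
  · refine Finset.sum_le_sum fun a ha => ?_
    refine sum_sq_wcoef_le_wcoef_single hf j (by rw [Finset.mem_Ico] at ha; omega) _ fun α hα => ?_
    exact (Finset.mem_filter.1 hα).2
  · rw [Finset.mem_filter] at hα
    exact Finset.mem_Ico.2 ⟨Nat.one_le_iff_ne_zero.2 hα.2, hS α hα.1 j⟩

/-- For every monotone `f ∈ F_mon^d`, `1 ≤ k ≤ d` and resolution `r ≥ 1`,
the Haar coefficients with more than `k` active variables and all levels `< r` (i.e. all
`α ∈ ℕ₀^d` with `α_j < 2^r`) satisfy `Σ f̃(α)² ≤ √(d·r)/(k+1)`. -/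
theorem statement6 (d k r : ℕ) (hd : 1 ≤ d) (hk : 1 ≤ k) (hkd : k ≤ d) (hr : 1 ≤ r)
    (f : (Fin d → ℝ) → ℝ) (hf : f ∈ FMon d) :
    ∑ α ∈ Finset.univ.filter
        (fun α : Fin d → Fin (2 ^ r) => k < activeCount (fun j => (α j : ℕ))),
      (wcoef f (fun j => (α j : ℕ))) ^ 2
      ≤ Real.sqrt ((d : ℝ) * r) / ((k : ℝ) + 1) := by
  set e : (Fin d → Fin (2 ^ r)) → Fin d → ℕ := fun α j => (α j : ℕ) with he
  have hinj : Function.Injective e := fun α β h =>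
    funext fun j => Fin.ext (congrFun h j)
  set T := Finset.univ.filter fun α : Fin d → Fin (2 ^ r) => k < activeCount (e α) with hT
  have h := sum_activeCount_mul_sq_wcoef_le r hf (T.image e) fun α hα j => by
    obtain ⟨β, -, rfl⟩ := Finset.mem_image.1 hα
    exact (β j).2
  rw [Finset.sum_image hinj.injOn] at h
  rw [le_div_iff₀ (by positivity), Finset.sum_mul]
  refine (Finset.sum_le_sum fun α hα => ?_).trans h
  have hk' : (k : ℝ) + 1 ≤ activeCount (e α) := by exact_mod_cast (Finset.mem_filter.1 hα).2
  rw [mul_comm]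
  exact mul_le_mul_of_nonneg_right hk' (sq_nonneg _)

end
end

section
/- Let f ∈ F_mon^d, let j ∈ {1,…,d}, and let α = 2^λ + κ ≥ 1 with λ ∈ ℕ₀ and 0 ≤ κ < 2^λ. Then the wavelet coefficient along the j-th coordinate dominates the weighted sum of squared coefficients sharing the index α in coordinate j: f̃(α·e_j) ≥ 2^{λ/2} · Σ_{α''∈ℕ₀^d : α''_j = α} f̃(α'')², where e_j is the j-th standard basis vector of ℝ^d. -/
open MeasureTheory
open scoped ENNReal NNReal

noncomputable section

theorem dyadicI_subset_Icc {l k : ℕ} (hk : k < 2 ^ l) : dyadicI l k ⊆ Set.Icc 0 1 := by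
  have hk' : (k : ℝ) + 1 ≤ 2 ^ l := by exact_mod_cast hk
  unfold dyadicI
  split_ifs
  · exact Set.Icc_subset_Icc_left (by positivity)
  · exact Set.Ico_subset_Icc_self.trans
      (Set.Icc_subset_Icc (by positivity) ((div_le_one (by positivity)).2 hk'))

theorem measurableSet_dyadicI (l k : ℕ) : MeasurableSet (dyadicI l k) := by
  unfold dyadicI
  split_ifs <;> measurability

theorem volume_real_dyadicI (l k : ℕ) : volume.real (dyadicI l k) = (2 ^ l)⁻¹ := by
  unfold dyadicI
  split_ifs with h
  · have h' : (k : ℝ) + 1 = 2 ^ l := by exact_mod_cast h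
    have hle : (k : ℝ) / 2 ^ l ≤ 1 := (div_le_one (by positivity)).2 (by linarith)
    rw [Real.volume_real_Icc_of_le hle]
    field_simp
    linarith
  · rw [Real.volume_real_Ico_of_le (by gcongr; linarith)]
    ring

theorem mem_dyadicI_iff_s7 {l k : ℕ} {x : ℝ} (hx : x ∈ Set.Ico (0 : ℝ) 1) :
    x ∈ dyadicI l k ↔ ⌊2 ^ l * x⌋₊ = k := by
  have hp : (0 : ℝ) < 2 ^ l := by positivity
  have hIco : x ∈ Set.Ico ((k : ℝ) / 2 ^ l) (((k : ℝ) + 1) / 2 ^ l) ↔ ⌊2 ^ l * x⌋₊ = k := by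
    rw [Nat.floor_eq_iff (mul_nonneg hp.le hx.1), Set.mem_Ico, div_le_iff₀' hp, lt_div_iff₀' hp]
  unfold dyadicI
  split_ifs with h
  · have h' : ((k : ℝ) + 1) / 2 ^ l = 1 := (div_eq_one_iff_eq hp.ne').2 (by exact_mod_cast h)
    rw [← hIco, h']
    exact ⟨fun hm => ⟨hm.1, hx.2⟩, fun hm => ⟨hm.1, hx.2.le⟩⟩
  · exact hIco

theorem mem_dyadicI_iff_of_ne_one (l k : ℕ) {x : ℝ} (hx : x ≠ 1) :
    x ∈ dyadicI l k ↔ x ∈ Set.Ico ((k : ℝ) / 2 ^ l) (((k : ℝ) + 1) / 2 ^ l) := by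
  unfold dyadicI
  split_ifs with h
  · have h' : ((k : ℝ) + 1) / 2 ^ l = 1 :=
      (div_eq_one_iff_eq (by positivity)).2 (by exact_mod_cast h)
    rw [h', Set.mem_Icc, Set.mem_Ico, hx.le_iff_lt]
  · rfl

theorem disjoint_dyadicI_succ {l k : ℕ} (h : k + 1 ≠ 2 ^ l) :
    Disjoint (dyadicI l (k + 1)) (dyadicI l k) := by
  rw [Set.disjoint_left]
  intro x hx hx'
  have hle : ((k : ℝ) + 1) / 2 ^ l ≤ x := by
    unfold dyadicI at hx
    split_ifs at hx <;> simpa using hx.1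
  rw [dyadicI, if_neg h] at hx'
  exact hx'.2.not_ge hle

theorem haar1_zero : haar1 0 = (Set.Icc (0 : ℝ) 1).indicator 1 := if_pos rfl

theorem haar1_two_pow_add {l k : ℕ} (hk : k < 2 ^ l) (x : ℝ) :
    haar1 (2 ^ l + k) x = √(2 ^ l) *
      ((dyadicI (l + 1) (2 * k + 1)).indicator 1 x - (dyadicI (l + 1) (2 * k)).indicator 1 x) := by
  have hlog : Nat.log 2 (2 ^ l + k) = l :=
    Nat.log_eq_of_pow_le_of_lt_pow (by omega) (by rw [pow_succ]; omega)
  simp [haar1, hlog]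

theorem exists_eq_two_pow_add {a : ℕ} (ha : a ≠ 0) : ∃ l k, k < 2 ^ l ∧ a = 2 ^ l + k := by
  have h₁ := Nat.pow_log_le_self 2 ha
  have h₂ := Nat.lt_pow_succ_log_self one_lt_two a
  rw [pow_succ] at h₂
  exact ⟨Nat.log 2 a, a - 2 ^ Nat.log 2 a, by omega, by omega⟩

theorem haar1_eq_zero_of_notMem (a : ℕ) {x : ℝ} (hx : x ∉ Set.Icc (0 : ℝ) 1) :
    haar1 a x = 0 := by
  rcases eq_or_ne a 0 with rfl | ha
  · rw [haar1_zero, Set.indicator_of_notMem hx]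
  · obtain ⟨l, k, hk, rfl⟩ := exists_eq_two_pow_add ha
    have hk₁ : 2 * k + 1 < 2 ^ (l + 1) := by rw [pow_succ]; omega
    rw [haar1_two_pow_add hk, Set.indicator_of_notMem fun h => hx (dyadicI_subset_Icc hk₁ h),
      Set.indicator_of_notMem fun h => hx (dyadicI_subset_Icc (by omega) h)]
    simp

theorem measurable_haar1 (a : ℕ) : Measurable (haar1 a) := by
  rcases eq_or_ne a 0 with rfl | ha
  · rw [haar1_zero]
    exact measurable_one.indicator measurableSet_Icc
  · obtain ⟨l, k, hk, rfl⟩ := exists_eq_two_pow_add ha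
    rw [funext (haar1_two_pow_add hk)]
    exact ((measurable_one.indicator (measurableSet_dyadicI _ _)).sub
      (measurable_one.indicator (measurableSet_dyadicI _ _))).const_mul _

theorem integrable_indicator_dyadicI (l k : ℕ) :
    Integrable ((dyadicI l k).indicator (1 : ℝ → ℝ)) := by
  refine (integrable_indicator_iff (measurableSet_dyadicI l k)).2 (integrableOn_const ?_)
  have : volume.real (dyadicI l k) ≠ 0 := by rw [volume_real_dyadicI]; positivity
  exact fun h => this (by simp [Measure.real, h])

theorem integral_haar1 {a : ℕ} (ha : a ≠ 0) : ∫ x, haar1 a x = 0 := by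
  obtain ⟨l, k, hk, rfl⟩ := exists_eq_two_pow_add ha
  simp_rw [haar1_two_pow_add hk]
  rw [integral_const_mul, integral_sub (integrable_indicator_dyadicI _ _)
    (integrable_indicator_dyadicI _ _), integral_indicator_one (measurableSet_dyadicI _ _),
    integral_indicator_one (measurableSet_dyadicI _ _), volume_real_dyadicI, volume_real_dyadicI]
  simp

theorem haar1_mul_self {l k : ℕ} (hk : k < 2 ^ l) (x : ℝ) :
    haar1 (2 ^ l + k) x * haar1 (2 ^ l + k) x = 2 ^ l *
      ((dyadicI (l + 1) (2 * k + 1)).indicator 1 x + (dyadicI (l + 1) (2 * k)).indicator 1 x) := by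
  have hs : √(2 ^ l) * √(2 ^ l) = (2 : ℝ) ^ l := Real.mul_self_sqrt (by positivity)
  have hd : x ∈ dyadicI (l + 1) (2 * k + 1) → x ∉ dyadicI (l + 1) (2 * k) := fun h =>
    Set.disjoint_left.1 (disjoint_dyadicI_succ (by rw [pow_succ]; omega)) h
  rw [haar1_two_pow_add hk, mul_mul_mul_comm, hs]
  by_cases h₁ : x ∈ dyadicI (l + 1) (2 * k + 1) <;> by_cases h₂ : x ∈ dyadicI (l + 1) (2 * k)
  · exact absurd h₂ (hd h₁)
  all_goals simp [h₁, h₂]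

theorem integrable_haar1_sq (a : ℕ) : Integrable fun x => haar1 a x * haar1 a x := by
  rcases eq_or_ne a 0 with rfl | ha
  · rw [haar1_zero]
    simp_rw [← Set.indicator_mul]
    exact (integrable_indicator_iff measurableSet_Icc).2 (by simp [integrableOn_const_iff])
  · obtain ⟨l, k, hk, rfl⟩ := exists_eq_two_pow_add ha
    simp_rw [haar1_mul_self hk]
    exact ((integrable_indicator_dyadicI _ _).add (integrable_indicator_dyadicI _ _)).const_mul _

theorem integral_haar1_sq (a : ℕ) : ∫ x, haar1 a x * haar1 a x = 1 := by
  rcases eq_or_ne a 0 with rfl | ha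
  · rw [haar1_zero]
    simp_rw [← Set.indicator_mul]
    simp [integral_indicator measurableSet_Icc]
  · obtain ⟨l, k, hk, rfl⟩ := exists_eq_two_pow_add ha
    simp_rw [haar1_mul_self hk]
    rw [integral_const_mul, integral_add (integrable_indicator_dyadicI _ _)
      (integrable_indicator_dyadicI _ _), integral_indicator_one (measurableSet_dyadicI _ _),
      integral_indicator_one (measurableSet_dyadicI _ _), volume_real_dyadicI, volume_real_dyadicI]
    field_simp
    ring

theorem haar1_two_pow_add_of_mem_Ico {l k : ℕ} (hk : k < 2 ^ l) {x : ℝ}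
    (hx : x ∈ Set.Ico (0 : ℝ) 1) :
    haar1 (2 ^ l + k) x = √(2 ^ l) *
      ((if ⌊2 ^ (l + 1) * x⌋₊ = 2 * k + 1 then 1 else 0) -
        (if ⌊2 ^ (l + 1) * x⌋₊ = 2 * k then 1 else 0)) := by
  rw [haar1_two_pow_add hk]
  simp [Set.indicator, mem_dyadicI_iff_s7 hx]

theorem floor_two_pow_mul_div (m n : ℕ) (x : ℝ) :
    ⌊2 ^ (m + n) * x⌋₊ / 2 ^ n = ⌊2 ^ m * x⌋₊ := by
  rw [← Nat.floor_div_natCast]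
  congr 1
  push_cast
  field_simp
  ring

/-- A Haar function of smaller index is constant on the interior of the support of one of larger
index. -/
theorem exists_haar1_mul_eq {a b : ℕ} (hab : a < b) :
    ∃ c : ℝ, ∀ x ∈ Set.Ico (0 : ℝ) 1, haar1 a x * haar1 b x = c * haar1 b x := by
  rcases eq_or_ne a 0 with rfl | ha
  · refine ⟨1, fun x hx => ?_⟩
    rw [haar1_zero, Set.indicator_of_mem (Set.Ico_subset_Icc_self hx), Pi.one_apply]
  obtain ⟨l, k, hk, rfl⟩ := exists_eq_two_pow_add ha
  obtain ⟨m, n, hn, rfl⟩ := exists_eq_two_pow_add (by omega : b ≠ 0)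
  have hlm : l ≤ m := by
    by_contra! h
    have : 2 ^ (m + 1) ≤ 2 ^ l := Nat.pow_le_pow_right two_pos h
    rw [pow_succ] at this
    omega
  have hsupp : ∀ x ∈ Set.Ico (0 : ℝ) 1, haar1 (2 ^ m + n) x ≠ 0 → ⌊2 ^ m * x⌋₊ = n := by
    intro x hx hne
    rw [← floor_two_pow_mul_div m 1]
    rw [haar1_two_pow_add_of_mem_Ico hn hx] at hne
    by_contra h
    refine hne ?_
    rw [if_neg (by omega), if_neg (by omega)]
    simp
  rcases hlm.eq_or_lt with rfl | hlm
  · refine ⟨0, fun x hx => ?_⟩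
    by_cases hb : haar1 (2 ^ l + n) x = 0
    · simp [hb]
    have h₁ := hsupp x hx hb
    have h₂ := floor_two_pow_mul_div l 1 x
    rw [haar1_two_pow_add_of_mem_Ico hk hx, if_neg (by omega), if_neg (by omega)]
    simp
  · obtain ⟨p, rfl⟩ := Nat.exists_eq_add_of_le (Nat.succ_le_of_lt hlm)
    refine ⟨√(2 ^ l) * ((if n / 2 ^ p = 2 * k + 1 then 1 else 0) -
        (if n / 2 ^ p = 2 * k then 1 else 0)), fun x hx => ?_⟩
    by_cases hb : haar1 (2 ^ (l.succ + p) + n) x = 0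
    · simp [hb]
    rw [haar1_two_pow_add_of_mem_Ico hk hx, ← hsupp x hx hb, floor_two_pow_mul_div]

theorem integral_haar1_mul_of_lt {a b : ℕ} (hab : a < b) : ∫ x, haar1 a x * haar1 b x = 0 := by
  obtain ⟨c, hc⟩ := exists_haar1_mul_eq hab
  have hae : (fun x => haar1 a x * haar1 b x) =ᵐ[volume] fun x => c * haar1 b x := by
    filter_upwards [Measure.ae_ne volume (1 : ℝ)] with x hx
    by_cases hx' : x ∈ Set.Icc (0 : ℝ) 1
    · exact hc x ⟨hx'.1, lt_of_le_of_ne hx'.2 hx⟩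
    · simp [haar1_eq_zero_of_notMem _ hx']
  rw [integral_congr_ae hae, integral_const_mul, integral_haar1 (by omega), mul_zero]

theorem integral_haar1_mul_of_ne {a b : ℕ} (hab : a ≠ b) : ∫ x, haar1 a x * haar1 b x = 0 := by
  rcases hab.lt_or_gt with h | h
  · exact integral_haar1_mul_of_lt h
  · simp_rw [mul_comm (haar1 a _)]
    exact integral_haar1_mul_of_lt h

theorem memLp_haar1 (a : ℕ) : MemLp (haar1 a) 2 := by
  rw [memLp_two_iff_integrable_sq (measurable_haar1 a).aestronglyMeasurable]
  simpa only [sq] using integrable_haar1_sq a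

theorem integrable_haar1 (a : ℕ) : Integrable (haar1 a) := by
  have h := (memLp_haar1 a).integrable_mul (memLp_haar1 0)
  refine h.congr (.of_forall fun x => ?_)
  by_cases hx : x ∈ Set.Icc (0 : ℝ) 1
  · simp [haar1_zero, hx]
  · simp [haar1_eq_zero_of_notMem _ hx]

/-- Every function that is monotone for the product order is almost everywhere measurable. -/
theorem Monotone.aemeasurable_pi {ι : Type*} [Fintype ι] {g : (ι → ℝ) → ℝ} (hg : Monotone g) :
    AEMeasurable g := by
  refine NullMeasurable.aemeasurable ?_
  refine measurable_of_Ioi (δ := NullMeasurableSpace (ι → ℝ) volume) fun c => ?_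
  have hup : IsUpperSet (g ⁻¹' Set.Ioi c) := fun x y hxy hx => lt_of_lt_of_le hx (hg hxy)
  exact hup.ordConnected.nullMeasurableSet

/-- The projection of `ℝ^d` onto the unit cube, followed by `f`. -/
def cubeExtend {d : ℕ} (f : (Fin d → ℝ) → ℝ) (x : Fin d → ℝ) : ℝ := f ((x ⊔ 0) ⊓ 1)

theorem cubeExtend_of_mem {d : ℕ} (f : (Fin d → ℝ) → ℝ) {x : Fin d → ℝ} (hx : x ∈ unitCube d) :
    cubeExtend f x = f x := by
  rw [cubeExtend, sup_eq_left.2 hx.1, inf_eq_left.2 hx.2]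

theorem clamp_mem_unitCube {d : ℕ} (x : Fin d → ℝ) : (x ⊔ 0) ⊓ 1 ∈ unitCube d :=
  ⟨le_inf le_sup_right zero_le_one, inf_le_right⟩

theorem monotone_cubeExtend {d : ℕ} {f : (Fin d → ℝ) → ℝ} (hf : f ∈ FMon d) :
    Monotone (cubeExtend f) := fun x y hxy =>
  hf.2 _ (clamp_mem_unitCube x) _ (clamp_mem_unitCube y)
    (inf_le_inf_right _ (sup_le_sup_right hxy _))

theorem cubeExtend_mem_Icc {d : ℕ} {f : (Fin d → ℝ) → ℝ} (hf : f ∈ FMon d) (x : Fin d → ℝ) :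
    cubeExtend f x ∈ Set.Icc (-1 : ℝ) 1 :=
  hf.1 _ (clamp_mem_unitCube x)

theorem haar_eq_zero_of_notMem {d : ℕ} (β : Fin d → ℕ) {x : Fin d → ℝ} (hx : x ∉ unitCube d) :
    haar β x = 0 := by
  have hx' : ∃ i, x i ∉ Set.Icc (0 : ℝ) 1 := by
    by_contra! h
    exact hx ⟨fun i => (h i).1, fun i => (h i).2⟩
  obtain ⟨i, hi⟩ := hx'
  exact Finset.prod_eq_zero (Finset.mem_univ i) (haar1_eq_zero_of_notMem _ hi)

theorem wcoef_eq_integral_cubeExtend {d : ℕ} (f : (Fin d → ℝ) → ℝ) (β : Fin d → ℕ) :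
    wcoef f β = ∫ x, haar β x * cubeExtend f x := by
  have hsupp : ∀ x, x ∉ unitCube d → haar β x * cubeExtend f x = 0 := fun x hx => by
    rw [haar_eq_zero_of_notMem β hx, zero_mul]
  rw [wcoef, ← setIntegral_eq_integral_of_forall_compl_eq_zero hsupp]
  have hm : MeasurableSet (unitCube d) := measurableSet_Icc
  refine setIntegral_congr_fun hm fun x hx => ?_
  simp only [cubeExtend_of_mem f hx]

/-- The tensor-product Haar function with its factor in coordinate `j` replaced by `u`. -/
def haarUpdate {d : ℕ} (j : Fin d) (u : ℝ → ℝ) (β : Fin d → ℕ) (x : Fin d → ℝ) : ℝ :=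
  ∏ i, Function.update (fun i => haar1 (β i)) j u i (x i)

section HaarUpdate

variable {d : ℕ} (j : Fin d)

theorem haarUpdate_eq_mul_prod_erase (u : ℝ → ℝ) (β : Fin d → ℕ) (x : Fin d → ℝ) :
    haarUpdate j u β x = u (x j) * ∏ i ∈ Finset.univ.erase j, haar1 (β i) (x i) := by
  rw [haarUpdate, ← Finset.mul_prod_erase _ _ (Finset.mem_univ j), Function.update_self]
  congr 1
  refine Finset.prod_congr rfl fun i hi => ?_
  rw [Function.update_of_ne (Finset.ne_of_mem_erase hi)]

theorem haar_eq_mul_prod_erase (β : Fin d → ℕ) (x : Fin d → ℝ) :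
    haar β x = haar1 (β j) (x j) * ∏ i ∈ Finset.univ.erase j, haar1 (β i) (x i) :=
  (Finset.mul_prod_erase _ _ (Finset.mem_univ j)).symm

theorem haarUpdate_add_single (u : ℝ → ℝ) (β : Fin d → ℕ) (x : Fin d → ℝ) (δ : ℝ) :
    haarUpdate j u β (x + Pi.single j δ) = haarUpdate j (fun t => u (t + δ)) β x := by
  rw [haarUpdate_eq_mul_prod_erase, haarUpdate_eq_mul_prod_erase, Pi.add_apply, Pi.single_eq_same]
  congr 1
  refine Finset.prod_congr rfl fun i hi => ?_
  rw [Pi.add_apply, Pi.single_eq_of_ne (Finset.ne_of_mem_erase hi), add_zero]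

theorem integrable_haarUpdate {u : ℝ → ℝ} (hu : Integrable u) (β : Fin d → ℕ) :
    Integrable (haarUpdate j u β) := by
  refine Integrable.fintype_prod (f := Function.update (fun i => haar1 (β i)) j u) fun i => ?_
  rcases eq_or_ne i j with rfl | hij
  · rwa [Function.update_self]
  · rw [Function.update_of_ne hij]
    exact integrable_haar1 _

theorem memLp_haarUpdate {u : ℝ → ℝ} (hu : Integrable u) (hu' : MemLp u 2) (β : Fin d → ℕ) :
    MemLp (haarUpdate j u β) 2 := by
  rw [memLp_two_iff_integrable_sq (integrable_haarUpdate j hu β).aestronglyMeasurable]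
  simp_rw [haarUpdate, ← Finset.prod_pow]
  refine Integrable.fintype_prod
    (f := fun i t => Function.update (fun i => haar1 (β i)) j u i t ^ 2) fun i => ?_
  rcases eq_or_ne i j with rfl | hij
  · rw [Function.update_self]
    exact hu'.integrable_sq
  · rw [Function.update_of_ne hij]
    exact (memLp_haar1 _).integrable_sq

theorem integral_haarUpdate_mul (u v : ℝ → ℝ) (β γ : Fin d → ℕ) :
    ∫ x, haarUpdate j u β x * haarUpdate j v γ x =
      (∫ t, u t * v t) * ∏ i ∈ Finset.univ.erase j, ∫ t, haar1 (β i) t * haar1 (γ i) t := by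
  simp_rw [haarUpdate, ← Finset.prod_mul_distrib]
  rw [integral_fintype_prod_volume_eq_prod (fun i t =>
      Function.update (fun i => haar1 (β i)) j u i t *
        Function.update (fun i => haar1 (γ i)) j v i t),
    ← Finset.mul_prod_erase _ _ (Finset.mem_univ j), Function.update_self, Function.update_self]
  congr 1
  refine Finset.prod_congr rfl fun i hi => ?_
  rw [Function.update_of_ne (Finset.ne_of_mem_erase hi),
    Function.update_of_ne (Finset.ne_of_mem_erase hi)]

end HaarUpdate

/-- Bessel's inequality for an orthonormal family of square-integrable functions. -/
theorem tsum_sq_integral_mul_le {X ι : Type*} [MeasurableSpace X] {μ : Measure X} {v : ι → X → ℝ}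
    {h : X → ℝ} (hv : ∀ i, MemLp (v i) 2 μ) (hh : MemLp h 2 μ)
    (hone : ∀ i, ∫ x, v i x * v i x ∂μ = 1)
    (hzero : ∀ i k, i ≠ k → ∫ x, v i x * v k x ∂μ = 0) :
    ∑' i, (∫ x, v i x * h x ∂μ) ^ 2 ≤ ∫ x, h x * h x ∂μ := by
  have hinner : ∀ {p q : X → ℝ} (hp : MemLp p 2 μ) (hq : MemLp q 2 μ),
      inner ℝ (hp.toLp p) (hq.toLp q) = ∫ x, p x * q x ∂μ := by
    intro p q hp hq
    rw [L2.inner_def]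
    refine integral_congr_ae ?_
    filter_upwards [hp.coeFn_toLp, hq.coeFn_toLp] with x hpx hqx
    rw [hpx, hqx, real_inner_eq_re_inner]
    simp [mul_comm]
  have hon : Orthonormal ℝ fun i => (hv i).toLp (v i) := by
    refine ⟨fun i => ?_, fun i k hik => ?_⟩
    · rw [norm_eq_sqrt_real_inner, hinner, hone, Real.sqrt_one]
    · change inner ℝ _ _ = 0
      rw [hinner, hzero i k hik]
  have hB := hon.tsum_inner_products_le (hh.toLp h)
  simpa only [hinner, Real.norm_eq_abs, sq_abs, ← real_inner_self_eq_norm_sq] using hB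

theorem integrable_indicator_Ico (a b : ℝ) : Integrable ((Set.Ico a b).indicator (1 : ℝ → ℝ)) :=
  (integrable_indicator_iff measurableSet_Ico).2 (integrableOn_const (C := (1 : ℝ)) (by simp))

theorem haar1_eq_sub_translate {l k : ℕ} (hk : k < 2 ^ l) {x : ℝ} (hx : x ≠ 1) :
    let u : ℝ → ℝ := (Set.Ico ((2 * k : ℝ) / 2 ^ (l + 1)) ((2 * k + 1) / 2 ^ (l + 1))).indicator 1
    haar1 (2 ^ l + k) x = √(2 ^ l) * (u (x - (2 ^ (l + 1))⁻¹) - u x) := by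
  intro u
  have h₁ : x ∈ dyadicI (l + 1) (2 * k + 1) ↔ x - (2 ^ (l + 1))⁻¹ ∈
      Set.Ico ((2 * k : ℝ) / 2 ^ (l + 1)) ((2 * k + 1) / 2 ^ (l + 1)) := by
    rw [mem_dyadicI_iff_of_ne_one _ _ hx, Set.mem_Ico, Set.mem_Ico, le_sub_iff_add_le, sub_lt_iff_lt_add]
    push_cast
    simp only [add_div, one_div]
  have h₂ : x ∈ dyadicI (l + 1) (2 * k) ↔ x ∈
      Set.Ico ((2 * k : ℝ) / 2 ^ (l + 1)) ((2 * k + 1) / 2 ^ (l + 1)) := by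
    rw [mem_dyadicI_iff_of_ne_one _ _ hx]
    push_cast
    rfl
  rw [haar1_two_pow_add hk]
  simp only [u, Set.indicator, h₁, h₂, Pi.one_apply]

/-- A Haar coefficient of `f` as an integral of the increments of `f` across the midpoint of the
`j`-th dyadic interval. -/
theorem wcoef_eq_integral_increment {d : ℕ} {f : (Fin d → ℝ) → ℝ} (hf : f ∈ FMon d) (j : Fin d)
    {l k : ℕ} (hk : k < 2 ^ l) {β : Fin d → ℕ} (hβ : β j = 2 ^ l + k) :
    wcoef f β = √(2 ^ l) * ∫ x, haarUpdate j
      ((Set.Ico ((2 * k : ℝ) / 2 ^ (l + 1)) ((2 * k + 1) / 2 ^ (l + 1))).indicator 1) β x *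
        (cubeExtend f (x + Pi.single j (2 ^ (l + 1))⁻¹) - cubeExtend f x) := by
  set u : ℝ → ℝ := (Set.Ico ((2 * k : ℝ) / 2 ^ (l + 1)) ((2 * k + 1) / 2 ^ (l + 1))).indicator 1
    with hu
  set δ : ℝ := (2 ^ (l + 1))⁻¹ with hδ
  have hui : Integrable u := integrable_indicator_Ico _ _
  have hg := (monotone_cubeExtend hf).aemeasurable_pi.aestronglyMeasurable
  have hint : ∀ {w : ℝ → ℝ}, Integrable w →
      Integrable fun x => haarUpdate j w β x * cubeExtend f x := fun hw =>
    (integrable_haarUpdate j hw β).mul_bdd (c := 1) hg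
      (.of_forall fun x => abs_le.2 (cubeExtend_mem_Icc hf x))
  have hshift : ∀ x, haarUpdate j (fun t => u (t - δ)) β (x + Pi.single j δ) =
      haarUpdate j u β x := fun x => by
    simp only [haarUpdate_add_single, add_sub_cancel_right]
  have hae : (fun x => haar β x * cubeExtend f x) =ᵐ[volume] fun x => √(2 ^ l) *
      (haarUpdate j (fun t => u (t - δ)) β x * cubeExtend f x -
        haarUpdate j u β x * cubeExtend f x) := by
    filter_upwards [Measure.ae_eval_ne (μ := fun _ : Fin d => (volume : Measure ℝ)) j 1] with x hx
    rw [haar_eq_mul_prod_erase j, hβ, haar1_eq_sub_translate hk hx, haarUpdate_eq_mul_prod_erase,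
      haarUpdate_eq_mul_prod_erase]
    ring
  have hint' : Integrable fun x =>
      haarUpdate j u β x * cubeExtend f (x + Pi.single j δ) := by
    simpa only [hshift] using (hint (hui.comp_sub_right δ)).comp_add_right (Pi.single j δ)
  rw [wcoef_eq_integral_cubeExtend, integral_congr_ae hae, integral_const_mul,
    integral_sub (hint (hui.comp_sub_right δ)) (hint hui),
    ← integral_add_right_eq_self _ (Pi.single j δ)]
  simp only [hshift, mul_sub]
  rw [integral_sub hint' (hint hui), mul_sub]

theorem haar1_mul_haar1_zero (a : ℕ) (t : ℝ) : haar1 a t * haar1 0 t = haar1 a t := by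
  by_cases ht : t ∈ Set.Icc (0 : ℝ) 1
  · simp [haar1_zero, ht]
  · simp [haar1_eq_zero_of_notMem a ht]

theorem haarUpdate_mul_haarUpdate_zero {d : ℕ} (j : Fin d) {u : ℝ → ℝ} (hu : ∀ t, u t * u t = u t)
    (β : Fin d → ℕ) {γ : Fin d → ℕ} (hγ : ∀ i, i ≠ j → γ i = 0) (x : Fin d → ℝ) :
    haarUpdate j u β x * haarUpdate j u γ x = haarUpdate j u β x := by
  rw [haarUpdate_eq_mul_prod_erase, haarUpdate_eq_mul_prod_erase, mul_mul_mul_comm, hu,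
    ← Finset.prod_mul_distrib]
  congr 1
  refine Finset.prod_congr rfl fun i hi => ?_
  rw [hγ i (Finset.ne_of_mem_erase hi), haar1_mul_haar1_zero]

/-- Bessel's inequality for the Haar functions with their factor in coordinate `j` replaced by an
idempotent `u`, tested against a function with values in `[0, 2]`. -/
theorem tsum_sq_integral_haarUpdate_mul_le {d : ℕ} (j : Fin d) {u : ℝ → ℝ}
    (huu : ∀ t, u t * u t = u t) (hui : Integrable u) (hu0 : 0 < ∫ t, u t) (a : ℕ)
    {γ : Fin d → ℕ} (hγ : ∀ i, i ≠ j → γ i = 0) {G : (Fin d → ℝ) → ℝ}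
    (hGm : AEStronglyMeasurable G) (hG : ∀ x, G x ∈ Set.Icc (0 : ℝ) 2) :
    ∑' β : {β : Fin d → ℕ // β j = a}, (∫ x, haarUpdate j u β.1 x * G x) ^ 2 ≤
      2 * (∫ t, u t) * ∫ x, haarUpdate j u γ x * G x := by
  set m := ∫ t, u t
  have hu2 : MemLp u 2 := by
    rw [memLp_two_iff_integrable_sq hui.aestronglyMeasurable]
    simpa only [sq, huu] using hui
  have hBB := haarUpdate_mul_haarUpdate_zero j huu γ hγ
  have hGabs : ∀ x, ‖G x‖ ≤ 2 := fun x => by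
    rw [Real.norm_eq_abs, abs_of_nonneg (hG x).1]
    exact (hG x).2
  have hhint : Integrable fun x => haarUpdate j u γ x * G x :=
    (integrable_haarUpdate j hui γ).mul_bdd hGm (.of_forall hGabs)
  have hh2 : MemLp (fun x => haarUpdate j u γ x * G x) 2 := by
    refine (memLp_haarUpdate j hui hu2 γ).of_le_mul (c := 2) hhint.aestronglyMeasurable
      (.of_forall fun x => ?_)
    rw [norm_mul, mul_comm]
    exact mul_le_mul_of_nonneg_right (hGabs x) (norm_nonneg _)
  have hs : √m⁻¹ * √m⁻¹ = m⁻¹ := Real.mul_self_sqrt (by positivity)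
  have hpair : ∀ β β' : Fin d → ℕ,
      ∫ x, √m⁻¹ * haarUpdate j u β x * (√m⁻¹ * haarUpdate j u β' x) =
        ∏ i ∈ Finset.univ.erase j, ∫ t, haar1 (β i) t * haar1 (β' i) t := fun β β' => by
    have hmul : ∀ x, √m⁻¹ * haarUpdate j u β x * (√m⁻¹ * haarUpdate j u β' x) =
        m⁻¹ * (haarUpdate j u β x * haarUpdate j u β' x) := fun x => by
      rw [mul_mul_mul_comm, hs]
    simp_rw [hmul]
    rw [integral_const_mul, integral_haarUpdate_mul]
    simp_rw [huu]
    rw [inv_mul_cancel_left₀ hu0.ne']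
  have hbessel := tsum_sq_integral_mul_le
    (v := fun (β : {β : Fin d → ℕ // β j = a}) x => √m⁻¹ * haarUpdate j u β.1 x)
    (fun β => (memLp_haarUpdate j hui hu2 β.1).const_mul _) hh2
    (fun β => by rw [hpair, Finset.prod_eq_one fun i _ => integral_haar1_sq _])
    (fun β β' hne => by
      obtain ⟨i, hi⟩ := Function.ne_iff.1 (Subtype.coe_ne_coe.2 hne)
      have hij : i ≠ j := by
        rintro rfl
        exact hi (β.2.trans β'.2.symm)
      rw [hpair, Finset.prod_eq_zero (Finset.mem_erase.2 ⟨hij, Finset.mem_univ i⟩)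
        (integral_haar1_mul_of_ne hi)])
  have hterm : ∀ β : {β : Fin d → ℕ // β j = a},
      (∫ x, √m⁻¹ * haarUpdate j u β.1 x * (haarUpdate j u γ x * G x)) ^ 2 =
        m⁻¹ * (∫ x, haarUpdate j u β.1 x * G x) ^ 2 := fun β => by
    simp_rw [mul_assoc, ← mul_assoc (haarUpdate j u β.1 _),
      haarUpdate_mul_haarUpdate_zero j huu β.1 hγ]
    rw [integral_const_mul, mul_pow, Real.sq_sqrt (by positivity)]
  simp_rw [hterm] at hbessel
  rw [tsum_mul_left, inv_mul_le_iff₀ hu0] at hbessel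
  have hle : ∫ x, haarUpdate j u γ x * G x * (haarUpdate j u γ x * G x) ≤
      ∫ x, 2 * (haarUpdate j u γ x * G x) := by
    refine integral_mono_of_nonneg (.of_forall fun x => mul_self_nonneg _) (hhint.const_mul 2)
      (.of_forall fun x => ?_)
    have hB0 : 0 ≤ haarUpdate j u γ x := hBB x ▸ mul_self_nonneg _
    change haarUpdate j u γ x * G x * (haarUpdate j u γ x * G x) ≤ 2 * (haarUpdate j u γ x * G x)
    rw [mul_mul_mul_comm, hBB]
    nlinarith [mul_nonneg hB0 (mul_nonneg (hG x).1 (sub_nonneg.2 (hG x).2))]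
  rw [integral_const_mul] at hle
  refine hbessel.trans ((mul_le_mul_of_nonneg_left hle hu0.le).trans_eq ?_)
  ring

/-- For `f ∈ F_mon^d`, a coordinate `j`, and `α = 2^λ + κ ≥ 1` with
`0 ≤ κ < 2^λ`, the coefficient along the `j`-th coordinate dominates the weighted sum of
squared coefficients sharing the index `α` in coordinate `j`:
`f̃(α·e_j) ≥ 2^{λ/2} · Σ_{α'' : α''_j = α} f̃(α'')²`. -/
theorem statement7 (d : ℕ) (f : (Fin d → ℝ) → ℝ) (hf : f ∈ FMon d) (j : Fin d)
    (lam kap α : ℕ) (hkap : kap < 2 ^ lam) (hα : α = 2 ^ lam + kap) :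
    Real.sqrt (2 ^ lam) *
        ∑' α'' : {β : Fin d → ℕ // β j = α}, (wcoef f α''.1) ^ 2
      ≤ wcoef f (fun j' => if j' = j then α else 0) := by
  subst hα
  set γ : Fin d → ℕ := fun j' => if j' = j then 2 ^ lam + kap else 0
  set I := Set.Ico ((2 * kap : ℝ) / 2 ^ (lam + 1)) ((2 * kap + 1) / 2 ^ (lam + 1))
  set δ : ℝ := (2 ^ (lam + 1))⁻¹ with hδ
  have huu : ∀ t, I.indicator (1 : ℝ → ℝ) t * I.indicator 1 t = I.indicator 1 t := fun t => by
    by_cases ht : t ∈ I <;> simp [ht]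
  have hIu : ∫ t, I.indicator (1 : ℝ → ℝ) t = δ := by
    rw [integral_indicator_one measurableSet_Ico, Real.volume_real_Ico_of_le (by gcongr; linarith)]
    ring
  have hgm := (monotone_cubeExtend hf).aemeasurable_pi.aestronglyMeasurable
  have hpres := measurePreserving_add_right (volume : Measure (Fin d → ℝ)) (Pi.single j δ)
  have hGm : AEStronglyMeasurable fun x =>
      cubeExtend f (x + Pi.single j δ) - cubeExtend f x :=
    (hgm.comp_measurePreserving hpres).fun_sub hgm
  have hG : ∀ x, cubeExtend f (x + Pi.single j δ) - cubeExtend f x ∈ Set.Icc (0 : ℝ) 2 := by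
    refine fun x => ⟨sub_nonneg.2 <| monotone_cubeExtend hf <|
      le_add_of_nonneg_right (Pi.single_nonneg.2 (by positivity)), ?_⟩
    linarith [(cubeExtend_mem_Icc hf (x + Pi.single j δ)).2, (cubeExtend_mem_Icc hf x).1]
  have hbessel := tsum_sq_integral_haarUpdate_mul_le j huu (integrable_indicator_Ico _ _)
    (by rw [hIu]; positivity) (2 ^ lam + kap) (γ := γ) (fun i hi => if_neg hi) hGm hG
  rw [hIu] at hbessel
  have hγj : γ j = 2 ^ lam + kap := if_pos rfl
  rw [wcoef_eq_integral_increment hf j hkap hγj]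
  refine mul_le_mul_of_nonneg_left ?_ (Real.sqrt_nonneg _)
  have hsq : ∀ β : {β : Fin d → ℕ // β j = 2 ^ lam + kap}, wcoef f β.1 ^ 2 =
      2 ^ lam * (∫ x, haarUpdate j (I.indicator 1) β.1 x *
        (cubeExtend f (x + Pi.single j δ) - cubeExtend f x)) ^ 2 := fun β => by
    rw [wcoef_eq_integral_increment hf j hkap β.2, mul_pow, Real.sq_sqrt (by positivity)]
  simp_rw [hsq]
  rw [tsum_mul_left]
  refine (mul_le_mul_of_nonneg_left hbessel (by positivity)).trans_eq ?_
  have hδ1 : 2 ^ lam * (2 * δ) = 1 := by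
    rw [← mul_assoc, ← pow_succ, hδ, mul_inv_cancel₀ (by positivity)]
  rw [← mul_assoc, hδ1, one_mul]

end
end
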